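/- A closed convex curve in $\mathbb{R}^d$ exists only when $d$ is even; that is, if $d$ is odd then there is no continuous map $C \colon [0,1] \to \mathbb{R}^d$ with $C(0) = C(1)$ such that every affine hyperplane $H \subset \mathbb{R}^d$ satisfies $|\{t \in [0,1) : C(t) \in H\}| \le d$. -/

import Mathlib

open Set

/-- An affine hyperplane in ℝ^d, given as the zero set of a non-trivial affine functional. -/
def IsAffHyperplane {d : ℕ} (H : Set (Fin d → ℝ)) : Prop :=
  ∃ (u : Fin d → ℝ) (c : ℝ), u ≠ 0 ∧ H = {x | ∑ j, u j * x j = c}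

/-- The matrix whose rows are the points `C ((i + s) / (d + 1))`, `0 ≤ i ≤ d`, in homogeneous
coordinates. -/
noncomputable def shiftedPointsMatrix {d : ℕ} (C : ℝ → (Fin d → ℝ)) (s : ℝ) :
    Matrix (Fin (d + 1)) (Fin (d + 1)) ℝ :=
  Matrix.of fun i => Fin.cons 1 (C (((i : ℕ) + s) / (d + 1)))

lemma shifted_param_mem_Icc {d : ℕ} (i : Fin (d + 1)) {s : ℝ} (hs : s ∈ Icc (0 : ℝ) 1) :
    ((i : ℕ) + s) / (d + 1 : ℝ) ∈ Icc (0 : ℝ) 1 := by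
  have hi : ((i : ℕ) : ℝ) ≤ d := by exact_mod_cast Nat.lt_succ_iff.mp i.isLt
  have := hs.1
  exact ⟨by positivity, by rw [div_le_one (by positivity)]; linarith [hs.2]⟩

lemma shifted_param_mem_Ico {d : ℕ} (i : Fin (d + 1)) {s : ℝ} (hs : s ∈ Ico (0 : ℝ) 1) :
    ((i : ℕ) + s) / (d + 1 : ℝ) ∈ Ico (0 : ℝ) 1 := by
  have hi : ((i : ℕ) : ℝ) ≤ d := by exact_mod_cast Nat.lt_succ_iff.mp i.isLt
  have := hs.1
  exact ⟨by positivity, by rw [div_lt_one (by positivity)]; linarith [hs.2]⟩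

lemma continuousOn_det_shiftedPointsMatrix {d : ℕ} {C : ℝ → (Fin d → ℝ)}
    (hC : ContinuousOn C (Icc 0 1)) :
    ContinuousOn (fun s => (shiftedPointsMatrix C s).det) (Icc 0 1) := by
  have hM : ContinuousOn (shiftedPointsMatrix C) (Icc 0 1) := by
    refine continuousOn_pi.2 fun i => continuousOn_pi.2 fun j => ?_
    refine Fin.cases ?_ (fun k => ?_) j
    · exact continuousOn_const
    · have hcomp : ContinuousOn (fun s : ℝ => C (((i : ℕ) + s) / (d + 1))) (Icc 0 1) :=
        hC.comp (by fun_prop) fun s hs => shifted_param_mem_Icc i hs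
      exact continuousOn_pi.1 hcomp k
  exact (continuous_id.matrix_det).comp_continuousOn hM

lemma shiftedPointsMatrix_one {d : ℕ} {C : ℝ → (Fin d → ℝ)} (hC : C 0 = C 1) :
    shiftedPointsMatrix C 1 = (shiftedPointsMatrix C 0).submatrix (finRotate (d + 1)) id := by
  ext i j
  have hrow : C (((i : ℕ) + 1) / (d + 1)) = C (((finRotate (d + 1) i : ℕ) + 0) / (d + 1)) := by
    rcases eq_or_ne i (Fin.last d) with rfl | hi
    · have hd : (d + 1 : ℝ) ≠ 0 := by positivity
      simp [div_self hd, hC]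
    · rw [coe_finRotate_of_ne_last hi]
      simp
  simp [shiftedPointsMatrix, hrow]

lemma det_shiftedPointsMatrix_one {d : ℕ} (hd : Odd d) {C : ℝ → (Fin d → ℝ)} (hC : C 0 = C 1) :
    (shiftedPointsMatrix C 1).det = -(shiftedPointsMatrix C 0).det := by
  rw [shiftedPointsMatrix_one hC, Matrix.det_permute, sign_finRotate, Nat.add_sub_cancel, hd.neg_one_pow]
  simp

/-- A curve meeting every hyperplane at most `d` times takes `d + 1` distinct parameters to
affinely independent points. -/
lemma det_shiftedPointsMatrix_ne_zero {d : ℕ} {C : ℝ → (Fin d → ℝ)}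
    (hC : ∀ H : Set (Fin d → ℝ), IsAffHyperplane H →
      {t ∈ Ico (0 : ℝ) 1 | C t ∈ H}.encard ≤ (d : ℕ∞))
    {s : ℝ} (hs : s ∈ Ico (0 : ℝ) 1) : (shiftedPointsMatrix C s).det ≠ 0 := by
  intro hdet
  obtain ⟨v, hv, hmul⟩ := Matrix.exists_mulVec_eq_zero_iff.2 hdet
  have hrow (i : Fin (d + 1)) :
      v 0 + ∑ j : Fin d, v j.succ * C (((i : ℕ) + s) / (d + 1)) j = 0 := by
    simpa [shiftedPointsMatrix, Matrix.mulVec, dotProduct, Fin.sum_univ_succ, mul_comm]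
      using congrFun hmul i
  have hu : (fun j : Fin d => v j.succ) ≠ 0 := by
    intro h
    have hsucc (j : Fin d) : v j.succ = 0 := congrFun h j
    have hzero : v 0 = 0 := by simpa [hsucc] using hrow 0
    exact hv (funext fun j => Fin.cases hzero hsucc j)
  have hcard := hC {x | ∑ j : Fin d, v j.succ * x j = -v 0} ⟨_, _, hu, rfl⟩
  have hinj : Function.Injective fun i : Fin (d + 1) => ((i : ℕ) + s) / (d + 1 : ℝ) := by
    intro i j hij
    have hd : (d + 1 : ℝ) ≠ 0 := by positivity
    have := (div_left_inj' hd).1 hij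
    exact Fin.ext (by exact_mod_cast add_right_cancel this)
  have hsub : range (fun i : Fin (d + 1) => ((i : ℕ) + s) / (d + 1 : ℝ)) ⊆
      {t ∈ Ico (0 : ℝ) 1 | C t ∈ {x | ∑ j : Fin d, v j.succ * x j = -v 0}} := by
    rintro _ ⟨i, rfl⟩
    exact ⟨shifted_param_mem_Ico i hs, eq_neg_of_add_eq_zero_right (hrow i)⟩
  have hle := (encard_le_encard hsub).trans hcard
  rw [← image_univ, hinj.encard_image, encard_univ, ENat.card_eq_coe_fintype_card,
    Fintype.card_fin, Nat.cast_le] at hle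
  omega

/-- If `d` is odd, then there is no closed convex curve in ℝ^d: no continuous map
`C : [0,1] → ℝ^d` with `C 0 = C 1` meeting every affine hyperplane in at most `d`
parameter values in `[0,1)`. -/
theorem no_closed_convex_curve_of_odd {d : ℕ} (hd : Odd d) :
    ¬ ∃ C : ℝ → (Fin d → ℝ), ContinuousOn C (Icc 0 1) ∧ C 0 = C 1 ∧
      ∀ H : Set (Fin d → ℝ), IsAffHyperplane H →
        {t ∈ Ico (0 : ℝ) 1 | C t ∈ H}.encard ≤ (d : ℕ∞) := by
  rintro ⟨C, hcont, hclosed, hC⟩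
  have hone := det_shiftedPointsMatrix_one hd hclosed
  have hzero := det_shiftedPointsMatrix_ne_zero hC (left_mem_Ico.2 one_pos)
  have hmem : (0 : ℝ) ∈ uIcc (shiftedPointsMatrix C 0).det (shiftedPointsMatrix C 1).det := by
    rw [hone, mem_uIcc]
    rcases le_total 0 (shiftedPointsMatrix C 0).det with h | h
    · exact Or.inr ⟨neg_nonpos.2 h, h⟩
    · exact Or.inl ⟨h, neg_nonneg.2 h⟩
  have hdet : ContinuousOn (fun s => (shiftedPointsMatrix C s).det) (uIcc 0 1) := by
    simpa only [uIcc_of_le zero_le_one] using continuousOn_det_shiftedPointsMatrix hcont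
  obtain ⟨s, hs, hs0⟩ := intermediate_value_uIcc hdet hmem
  rw [uIcc_of_le zero_le_one] at hs
  rcases hs.2.lt_or_eq with h | rfl
  · exact det_shiftedPointsMatrix_ne_zero hC ⟨hs.1, h⟩ hs0
  · exact hzero (neg_eq_zero.1 (hone.symm.trans hs0))
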